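/- Let X be a set, (𝒴, ℓ) a metric space, and ℋ a class of functions X → 𝒴 whose covering dimension Cdim(ℋ) with respect to d_∞(f, g) = sup_{x∈X} ℓ(f(x), g(x)) is finite. Let i ≥ 0 be an integer and let T be an ℋ-satisfiable (X,𝒴)-tree in which every leaf is at depth exactly D (i.e., every root-to-leaf path contains exactly D internal nodes) and every internal node label (x, y1, y2) satisfies ℓ(y1, y2) > 2^{-i}. Then D ≤ (i+1)·Cdim(ℋ). -/

import Mathlib

/-- `IsENet H S ε`: `S ⊆ H` is an `ε`-net of `H` for the metric
`d_∞(f, g) = sup_x ℓ(f x, g x)`. -/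
def IsENet {X Y : Type*} [MetricSpace Y] (H S : Set (X → Y)) (ε : ℝ) : Prop :=
  S ⊆ H ∧ ∀ f ∈ H, ∃ g ∈ S, ∀ x : X, dist (f x) (g x) ≤ ε

/-- The minimum cardinality of an `ε`-net of `H` (`⊤` if no finite `ε`-net exists). -/
noncomputable def coveringNumber {X Y : Type*} [MetricSpace Y]
    (H : Set (X → Y)) (ε : ℝ) : ℕ∞ :=
  sInf {n : ℕ∞ | ∃ S : Set (X → Y), S.Finite ∧ IsENet H S ε ∧ (S.ncard : ℕ∞) = n}

/-- The covering dimension `Cdim(H) = sup_{0 < ε ≤ 1/2} log N_ε(H) / log (1/ε)`. -/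
noncomputable def coveringDim {X Y : Type*} [MetricSpace Y] (H : Set (X → Y)) : ℝ :=
  sSup {c : ℝ | ∃ ε : ℝ, 0 < ε ∧ ε ≤ 1/2 ∧
    c = Real.log ((coveringNumber H ε).toNat : ℝ) / Real.log (1/ε)}

/-- An `(X, 𝒴)`-tree. -/
inductive LTree (X Y : Type*) where
  | leaf : LTree X Y
  | node : X → Y → Y → LTree X Y → LTree X Y → LTree X Y

/-- `LTree.Sat H t`: the tree `t` is `H`-satisfiable. -/
def LTree.Sat {X Y : Type*} : Set (X → Y) → LTree X Y → Prop
  | H, .leaf => H.Nonempty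
  | H, .node x y1 y2 l r => LTree.Sat {f ∈ H | f x = y1} l ∧ LTree.Sat {f ∈ H | f x = y2} r

/-- `t.uniformDepth D`: every leaf of `t` is at depth exactly `D`, i.e. every
root-to-leaf path contains exactly `D` internal nodes. -/
def LTree.uniformDepth {X Y : Type*} : LTree X Y → ℕ → Prop
  | .leaf, n => n = 0
  | .node _ _ _ l r, n => ∃ m, n = m + 1 ∧ l.uniformDepth m ∧ r.uniformDepth m

/-- `t.gapAbove ε`: every internal node label `(x, y₁, y₂)` of `t` satisfies
`ℓ(y₁, y₂) > ε`. -/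
def LTree.gapAbove {X Y : Type*} [MetricSpace Y] (ε : ℝ) : LTree X Y → Prop
  | .leaf => True
  | .node _ y1 y2 l r => ε < dist y1 y2 ∧ l.gapAbove ε ∧ r.gapAbove ε

/-- A finite `ε`-cover of a class satisfying a tree of uniform depth `D` with all gaps
above `2 * ε` has at least `2 ^ D` elements. -/
theorem LTree.two_pow_le_ncard_of_sat {X Y : Type*} [MetricSpace Y] {ε δ : ℝ}
    (hδ : 2 * ε ≤ δ) (t : LTree X Y) :
    ∀ {D : ℕ} {H S : Set (X → Y)}, t.Sat H → t.uniformDepth D → t.gapAbove δ → S.Finite →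
      (∀ f ∈ H, ∃ g ∈ S, ∀ x, dist (f x) (g x) ≤ ε) → 2 ^ D ≤ S.ncard := by
  induction t with
  | leaf =>
    rintro D H S ⟨f, hf⟩ hD - hS hcov
    obtain ⟨g, hg, -⟩ := hcov f hf
    obtain rfl : D = 0 := hD
    exact (Set.ncard_pos hS).2 ⟨g, hg⟩
  | node x y1 y2 l r ihl ihr =>
    rintro D H S ⟨hl, hr⟩ ⟨m, rfl, hml, hmr⟩ ⟨hgap, hgl, hgr⟩ hS hcov
    have hcov' (y : Y) : ∀ f ∈ {f ∈ H | f x = y}, ∃ g ∈ {g ∈ S | dist y (g x) ≤ ε},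
        ∀ z, dist (f z) (g z) ≤ ε := by
      rintro f ⟨hf, rfl⟩
      obtain ⟨g, hg, hfg⟩ := hcov f hf
      exact ⟨g, ⟨hg, hfg x⟩, hfg⟩
    have hdisj : Disjoint {g ∈ S | dist y1 (g x) ≤ ε} {g ∈ S | dist y2 (g x) ≤ ε} := by
      refine Set.disjoint_left.2 fun g h1 h2 => ?_
      have := dist_triangle_right y1 y2 (g x)
      linarith [h1.2, h2.2]
    have hfin (y : Y) : {g ∈ S | dist y (g x) ≤ ε}.Finite := hS.subset (Set.sep_subset _ _)
    have h1 := ihl hl hml hgl (hfin y1) (hcov' y1)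
    have h2 := ihr hr hmr hgr (hfin y2) (hcov' y2)
    have hunion := Set.ncard_union_eq hdisj (hfin y1) (hfin y2)
    have hle := Set.ncard_le_ncard
      (Set.union_subset (Set.sep_subset S fun g => dist y1 (g x) ≤ ε)
        (Set.sep_subset S fun g => dist y2 (g x) ≤ ε)) hS
    rw [pow_succ]
    lia

/-- A class satisfying a tree of uniform depth `D` with all gaps above `2 * ε` has
`ε`-covering number at least `2 ^ D`. -/
theorem two_pow_le_coveringNumber {X Y : Type*} [MetricSpace Y] {H : Set (X → Y)} {ε δ : ℝ}
    (hδ : 2 * ε ≤ δ) {t : LTree X Y} {D : ℕ} (hsat : t.Sat H) (hdepth : t.uniformDepth D)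
    (hgap : t.gapAbove δ) : ((2 ^ D : ℕ) : ℕ∞) ≤ coveringNumber H ε := by
  refine le_sInf ?_
  rintro n ⟨S, hS, ⟨-, hcov⟩, rfl⟩
  exact_mod_cast t.two_pow_le_ncard_of_sat hδ hsat hdepth hgap hS hcov


theorem stmt15 {X Y : Type*} [MetricSpace Y] (H : Set (X → Y))
    (hfin : ∀ ε : ℝ, 0 < ε → ε ≤ 1/2 → coveringNumber H ε ≠ ⊤)
    (hbdd : BddAbove {c : ℝ | ∃ ε : ℝ, 0 < ε ∧ ε ≤ 1/2 ∧
      c = Real.log ((coveringNumber H ε).toNat : ℝ) / Real.log (1/ε)})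
    (i D : ℕ) (t : LTree X Y)
    (hsat : LTree.Sat H t) (hdepth : t.uniformDepth D)
    (hgap : t.gapAbove ((2:ℝ) ^ (-(i:ℤ)))) :
    (D : ℝ) ≤ (i + 1) * coveringDim H := by
  have hlog2 : 0 < Real.log 2 := Real.log_pos one_lt_two
  have hpos : (0 : ℝ) < (1 / 2) ^ (i + 1) := by positivity
  have hhalf : (1 / 2 : ℝ) ^ (i + 1) ≤ 1 / 2 :=
    pow_le_of_le_one (by norm_num) (by norm_num) i.succ_ne_zero
  have hδ : 2 * (1 / 2 : ℝ) ^ (i + 1) ≤ 2 ^ (-(i : ℤ)) := by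
    rw [zpow_neg, zpow_natCast, pow_succ, one_div, inv_pow]
    linarith
  have hN : 2 ^ D ≤ (coveringNumber H ((1 / 2) ^ (i + 1))).toNat := by
    have h := two_pow_le_coveringNumber hδ hsat hdepth hgap
    rw [← ENat.natCast_toNat (hfin _ hpos hhalf)] at h
    exact_mod_cast h
  have hlogN : D * Real.log 2 ≤
      Real.log ((coveringNumber H ((1 / 2) ^ (i + 1))).toNat : ℝ) := by
    rw [← Real.log_pow]
    exact Real.log_le_log (by positivity) (by exact_mod_cast hN)
  have hlogε : Real.log (1 / (1 / 2 : ℝ) ^ (i + 1)) = (i + 1) * Real.log 2 := by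
    rw [one_div, one_div, inv_pow, inv_inv, Real.log_pow]
    push_cast
    rfl
  have hsup := le_csSup hbdd ⟨(1 / 2 : ℝ) ^ (i + 1), hpos, hhalf, rfl⟩
  change _ ≤ coveringDim H at hsup
  rw [hlogε, div_le_iff₀ (by positivity)] at hsup
  refine le_of_mul_le_mul_right ?_ hlog2
  linarith
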